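/- Fix a constant ε > 0 and for each n let p = p(n) = (2+ε)·(log n)/n. Then the probability under the random G(n,p)-game measure P_{(n,p)} that a pure Nash equilibrium exists converges to 1 − 1/e as n → ∞. -/

import Mathlib

open scoped Classical
open Finset

/-- Best-response tables of a game with `n` binary-strategy players: player `v`'s table
assigns a best response `ω v τ ∈ {0,1}` to each (masked) strategy profile `τ`.
Only the values at profiles vanishing outside the neighborhood of `v` are ever read,
so under the uniform measure the read entries are i.i.d. uniform on `{0,1}`. -/
abbrev Tables (n : ℕ) := Fin n → (Fin n → Bool) → Bool

/-- Potential edges of a graph on `Fin n`: ordered pairs `(u,v)` with `u < v`. -/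
abbrev EdgePair (n : ℕ) := {q : Fin n × Fin n // q.1 < q.2}

/-- A sample of the Erdős–Rényi graph: an indicator of presence for each potential edge. -/
abbrev GraphSeed (n : ℕ) := EdgePair n → Bool

/-- Adjacency relation of the graph determined by a graph seed. -/
def adjB {n : ℕ} (g : GraphSeed n) (u v : Fin n) : Bool :=
  if h : u < v then g ⟨(u, v), h⟩
  else if h' : v < u then g ⟨(v, u), h'⟩
  else false

/-- Restriction of a strategy profile to the neighborhood of `v`
(strategies outside the neighborhood are replaced by `false`). -/
def maskG {n : ℕ} (g : GraphSeed n) (v : Fin n) (σ : Fin n → Bool) : Fin n → Bool :=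
  fun u => if adjB g v u then σ u else false

/-- `σ` is a pure Nash equilibrium of the game on graph `g` with tables `ω`:
every player plays a best response to its neighborhood. -/
def isPNE {n : ℕ} (g : GraphSeed n) (ω : Tables n) (σ : Fin n → Bool) : Prop :=
  ∀ v, σ v = ω v (maskG g v σ)

/-- Erdős–Rényi weight of a graph seed: each potential edge is present independently
with probability `p`. -/
noncomputable def graphWeight {n : ℕ} (p : ℝ) (g : GraphSeed n) : ℝ :=
  ∏ e : EdgePair n, if g e then p else 1 - p

/-- Probability of a table event under the uniform measure on best-response tables. -/
noncomputable def probT (n : ℕ) (A : Tables n → Prop) : ℝ :=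
  (∑ ω : Tables n, if A ω then (1 : ℝ) else 0) / (Fintype.card (Tables n) : ℝ)

/-- Joint probability of an event under the random `G(n,p)`-game measure `P_{(n,p)}`:
first draw `g ~ G(n,p)`, then independent uniform best-response tables `ω`. -/
noncomputable def probGT (n : ℕ) (p : ℝ) (A : GraphSeed n → Tables n → Prop) : ℝ :=
  ∑ g : GraphSeed n, graphWeight p g * probT n (fun ω => A g ω)

/-- Solution of the Stein equation, shifted. -/
noncomputable def steinF (w : ℕ) : ℝ := ∫ t in (0:ℝ)..1, t ^ w * Real.exp (-t)

lemma steinF_zero : steinF 0 = 1 - Real.exp (-1) := by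
  have h : ∀ t ∈ Set.uIcc (0:ℝ) 1, HasDerivAt (fun t : ℝ => -Real.exp (-t)) (t ^ 0 * Real.exp (-t)) t := by
    intro t _
    have := ((hasDerivAt_neg t).exp).fun_neg
    simpa using this
  unfold steinF
  rw [intervalIntegral.integral_eq_sub_of_hasDerivAt h (by apply Continuous.intervalIntegrable; fun_prop)]
  simp; ring

lemma steinF_succ (w : ℕ) : steinF (w + 1) = (w + 1) * steinF w - Real.exp (-1) := by
  have h : ∀ t ∈ Set.uIcc (0:ℝ) 1, HasDerivAt (fun t : ℝ => -(t ^ (w+1) * Real.exp (-t)))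
      (t ^ (w+1) * Real.exp (-t) - (w + 1) * (t ^ w * Real.exp (-t))) t := by
    intro t _
    have := ((hasDerivAt_pow (w+1) t).fun_mul ((hasDerivAt_neg t).exp)).fun_neg
    refine this.congr_deriv ?_
    push_cast
    ring
  have h2 := intervalIntegral.integral_eq_sub_of_hasDerivAt h
    (by apply Continuous.intervalIntegrable; fun_prop)
  rw [intervalIntegral.integral_sub (by apply Continuous.intervalIntegrable; fun_prop)
    (by apply Continuous.intervalIntegrable; fun_prop), intervalIntegral.integral_const_mul] at h2
  unfold steinF
  simp at h2
  linarith

lemma steinF_mem (w : ℕ) : 0 ≤ steinF w ∧ steinF w ≤ 1 := by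
  constructor
  · apply intervalIntegral.integral_nonneg (by norm_num)
    intro t ht
    have := ht.1
    positivity
  · have : steinF w ≤ ∫ t in (0:ℝ)..1, (1:ℝ) := by
      apply intervalIntegral.integral_mono_on (by norm_num)
        (by apply Continuous.intervalIntegrable; fun_prop) (by simp)
      intro t ht
      exact mul_le_one₀ (pow_le_one₀ ht.1 ht.2) (Real.exp_pos _).le
        (Real.exp_le_one_iff.2 (by linarith [ht.1]))
    simpa using this

lemma steinF_lip (a b : ℕ) : |steinF (a + b) - steinF a| ≤ b := by
  rcases Nat.eq_zero_or_pos b with rfl | hb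
  · simp
  · have h1 := steinF_mem (a+b)
    have h2 := steinF_mem a
    have : (1:ℝ) ≤ b := by exact_mod_cast hb
    rw [abs_le]; constructor <;> linarith

/-- `w * steinF (w-1)` -/
lemma stein_eq (w : ℕ) :
    (if w = 0 then (1:ℝ) else 0) - Real.exp (-1) = steinF w - w * steinF (w - 1) := by
  rcases w with _ | w
  · simp [steinF_zero]
  · simp [steinF_succ]

lemma chen_stein {Ω ι : Type*} [Fintype Ω] [Fintype ι] [DecidableEq ι] [Nonempty ι]
    (X : ι → Ω → ℕ) (hX : ∀ i ω, X i ω ≤ 1) (B : ι → Finset ι) (hB : ∀ i, i ∈ B i)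
    (hind : ∀ i, ∀ h : ℕ → ℝ, (Fintype.card ι : ℝ) *
      ∑ ω, (X i ω : ℝ) * h (∑ j ∈ (B i)ᶜ, X j ω) = ∑ ω, h (∑ j ∈ (B i)ᶜ, X j ω)) :
    |∑ ω, ((if ∑ i, X i ω = 0 then (1:ℝ) else 0) - Real.exp (-1))| ≤
      (∑ i, ∑ j ∈ B i, ∑ ω, (X j ω : ℝ)) / (Fintype.card ι : ℝ) +
      ∑ i, ∑ j ∈ (B i).erase i, ∑ ω, (X i ω : ℝ) * X j ω := by
  set N : ℝ := (Fintype.card ι : ℝ) with hN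
  have hN0 : 0 < N := by rw [hN]; exact_mod_cast Fintype.card_pos
  have e1 : ∑ ω, ((if ∑ i, X i ω = 0 then (1:ℝ) else 0) - Real.exp (-1)) =
      ∑ i, ∑ ω, (N⁻¹ * steinF (∑ i, X i ω) - (X i ω : ℝ) * steinF ((∑ i, X i ω) - 1)) := by
    rw [Finset.sum_comm]
    apply Finset.sum_congr rfl
    intro ω _
    rw [stein_eq, Finset.sum_sub_distrib, ← Finset.sum_mul, Finset.sum_const, Finset.card_univ,
      nsmul_eq_mul, ← hN, mul_inv_cancel₀ hN0.ne', one_mul, Nat.cast_sum, Finset.sum_mul]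
  rw [e1, Finset.sum_div, ← Finset.sum_add_distrib]
  refine (Finset.abs_sum_le_sum_abs _ _).trans (Finset.sum_le_sum ?_)
  intro i _
  have hi := hind i steinF
  have e2 : ∑ ω, (N⁻¹ * steinF (∑ i, X i ω) - (X i ω : ℝ) * steinF ((∑ i, X i ω) - 1)) =
      ∑ ω, (N⁻¹ * (steinF (∑ i, X i ω) - steinF (∑ j ∈ (B i)ᶜ, X j ω)) -
        (X i ω : ℝ) * (steinF ((∑ i, X i ω) - 1) - steinF (∑ j ∈ (B i)ᶜ, X j ω))) := by
    simp only [mul_sub, Finset.sum_sub_distrib, ← Finset.mul_sum]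
    rw [← hi, ← mul_assoc, inv_mul_cancel₀ hN0.ne']
    ring
  rw [e2]
  refine (Finset.abs_sum_le_sum_abs _ _).trans ?_
  have e3 : (∑ j ∈ B i, ∑ ω, (X j ω : ℝ)) / N + ∑ j ∈ (B i).erase i, ∑ ω, (X i ω : ℝ) * X j ω
      = ∑ ω, (N⁻¹ * ∑ j ∈ B i, (X j ω : ℝ) + (X i ω : ℝ) * ∑ j ∈ (B i).erase i, (X j ω : ℝ)) := by
    rw [Finset.sum_comm, Finset.sum_comm (s := (B i).erase i), Finset.sum_add_distrib,
      ← Finset.mul_sum]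
    simp only [Finset.mul_sum]
    rw [div_eq_inv_mul, Finset.mul_sum]
    simp only [Finset.mul_sum]
  rw [e3]
  apply Finset.sum_le_sum
  intro ω _
  have s1 : ∑ i, X i ω = ∑ j ∈ (B i)ᶜ, X j ω + ∑ j ∈ B i, X j ω := by
    rw [add_comm]; exact (Finset.sum_add_sum_compl _ _).symm
  have s2 : ∑ j ∈ B i, X j ω = X i ω + ∑ j ∈ (B i).erase i, X j ω :=
    (Finset.add_sum_erase _ _ (hB i)).symm
  refine (abs_sub _ _).trans (add_le_add ?_ ?_)
  · rw [abs_mul, abs_of_pos (inv_pos.2 hN0), s1]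
    gcongr
    have := steinF_lip (∑ j ∈ (B i)ᶜ, X j ω) (∑ j ∈ B i, X j ω)
    push_cast at this ⊢
    exact this
  · rcases Nat.eq_zero_or_pos (X i ω) with h0 | h0
    · simp [h0]
    · have h1 : X i ω = 1 := le_antisymm (hX i ω) h0
      rw [s1, s2, h1]
      have := steinF_lip (∑ j ∈ (B i)ᶜ, X j ω) (∑ j ∈ (B i).erase i, X j ω)
      have e : ∑ j ∈ (B i)ᶜ, X j ω + (1 + ∑ j ∈ (B i).erase i, X j ω) - 1
        = ∑ j ∈ (B i)ᶜ, X j ω + ∑ j ∈ (B i).erase i, X j ω := by omega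
      rw [e]
      push_cast at this ⊢
      simpa using this

/-- Flip one table entry. -/
def flipT {n : ℕ} (v : Fin n) (m : Fin n → Bool) (ω : Tables n) : Tables n :=
  fun u τ => if u = v ∧ τ = m then !(ω u τ) else ω u τ

lemma flipT_invol {n : ℕ} (v : Fin n) (m : Fin n → Bool) :
    Function.Involutive (flipT v m) := by
  intro ω; funext u τ
  by_cases h : u = v ∧ τ = m <;> simp [flipT, h]

lemma flip_sum {n : ℕ} (v : Fin n) (m : Fin n → Bool) (a : Bool) (F : Tables n → ℝ)
    (hF : ∀ ω, F (flipT v m ω) = F ω) :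
    2 * ∑ ω : Tables n, (if a = ω v m then 1 else 0) * F ω = ∑ ω, F ω := by
  have h1 : ∑ ω : Tables n, (if a = ω v m then 1 else 0) * F ω =
      ∑ ω : Tables n, (if a = ω v m then 0 else 1) * F ω := by
    have e : ∀ ω, flipT v m ω v m = !(ω v m) := by intro ω; simp [flipT]
    refine Finset.sum_bijective (flipT v m) (flipT_invol v m).bijective (by simp) ?_
    intro ω _
    simp only [hF, e]
    congr 1
    cases a <;> cases ω v m <;> simp
  rw [two_mul]
  nth_rewrite 2 [h1]
  rw [← Finset.sum_add_distrib]
  apply Finset.sum_congr rfl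
  intro ω _
  split_ifs <;> ring

lemma indep_sum {n : ℕ} (M : Fin n → Fin n → Bool) (σ : Fin n → Bool) (D : Finset (Fin n))
    (F : Tables n → ℝ) (hF : ∀ v ∈ D, ∀ ω, F (flipT v (M v) ω) = F ω) :
    2 ^ D.card * ∑ ω : Tables n, (if ∀ v ∈ D, σ v = ω v (M v) then 1 else 0) * F ω = ∑ ω, F ω := by
  induction D using Finset.induction_on with
  | empty => simp
  | insert v D hv ih =>
    rw [← ih (fun u hu => hF u (Finset.mem_insert_of_mem hu)), Finset.card_insert_of_notMem hv,
      pow_succ, mul_assoc]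
    congr 1
    rw [← flip_sum v (M v) (σ v)
      (fun ω => (if ∀ v ∈ D, σ v = ω v (M v) then 1 else 0) * F ω)]
    · congr 1
      apply Finset.sum_congr rfl
      intro ω _
      rw [← mul_assoc]
      congr 1
      simp only [Finset.forall_mem_insert]
      split_ifs <;> simp_all
    · intro ω
      rw [hF v (Finset.mem_insert_self _ _)]
      congr 2
      apply propext
      refine forall₂_congr fun u hu => ?_
      have : u ≠ v := fun h => hv (h ▸ hu)
      simp [flipT, this]

/-- Pairs of nonempty disjoint sets with no edges in between. -/
noncomputable def pairsG {n : ℕ} (g : GraphSeed n) : Finset (Finset (Fin n) × Finset (Fin n)) :=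
  Finset.univ.filter (fun P => P.1.Nonempty ∧ P.2.Nonempty ∧ Disjoint P.1 P.2 ∧
    ∀ a ∈ P.2, ∀ u ∈ P.1, adjB g a u = false)

/-- Difference set of two profiles. -/
def diffS {n : ℕ} (σ τ : Fin n → Bool) : Finset (Fin n) := Finset.univ.filter (fun v => σ v ≠ τ v)

lemma mask_eq_iff {n : ℕ} (g : GraphSeed n) (v : Fin n) (σ τ : Fin n → Bool) :
    maskG g v τ = maskG g v σ ↔ ∀ u ∈ diffS σ τ, adjB g v u = false := by
  constructor
  · intro h u hu
    have := congrFun h u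
    simp only [diffS, Finset.mem_filter, Finset.mem_univ, true_and] at hu
    by_contra hc
    simp only [Bool.not_eq_false] at hc
    simp [maskG, hc] at this
    exact hu this.symm
  · intro h
    funext u
    by_cases hu : σ u = τ u
    · simp [maskG, hu]
    · have := h u (by simp [diffS, hu])
      simp [maskG, this]

lemma diffS_bij {n : ℕ} (σ : Fin n → Bool) : Function.Bijective (diffS σ) := by
  rw [Fintype.bijective_iff_injective_and_card]
  constructor
  · intro τ ρ h
    funext v
    have := congrArg (fun S => v ∈ S) h
    simp only [diffS, Finset.mem_filter, Finset.mem_univ, true_and] at this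
    revert this
    cases σ v <;> cases τ v <;> cases ρ v <;> simp
  · simp

/-- Indicator of being a PNE. -/
noncomputable def XP {n : ℕ} (g : GraphSeed n) (σ : Fin n → Bool) (ω : Tables n) : ℕ :=
  if isPNE g ω σ then 1 else 0

/-- Dependency neighbourhood. -/
noncomputable def BP {n : ℕ} (g : GraphSeed n) (σ : Fin n → Bool) : Finset (Fin n → Bool) :=
  Finset.univ.filter (fun τ => ∃ v, maskG g v τ = maskG g v σ)

lemma XP_indep {n : ℕ} (g : GraphSeed n) (σ : Fin n → Bool) (F : Tables n → ℝ)
    (hF : ∀ v, ∀ ω, F (flipT v (maskG g v σ) ω) = F ω) :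
    2 ^ n * ∑ ω : Tables n, (XP g σ ω : ℝ) * F ω = ∑ ω, F ω := by
  have := indep_sum (fun v => maskG g v σ) σ Finset.univ F (fun v _ => hF v)
  rw [Finset.card_univ, Fintype.card_fin] at this
  rw [← this]
  congr 1
  apply Finset.sum_congr rfl
  intro ω _
  congr 1
  by_cases h : isPNE g ω σ
  · rw [if_pos (fun v _ => h v)]; simp [XP, h]
  · rw [if_neg (fun h' => h (fun v => h' v (Finset.mem_univ v)))]; simp [XP, h]

lemma XP_mean {n : ℕ} (g : GraphSeed n) (σ : Fin n → Bool) :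
    ∑ ω : Tables n, (XP g σ ω : ℝ) = (Fintype.card (Tables n) : ℝ) / 2 ^ n := by
  have := XP_indep g σ (fun _ => 1) (by simp)
  rw [eq_div_iff (by positivity), mul_comm]
  simpa only [mul_one, Finset.sum_const, Finset.card_univ, nsmul_eq_mul] using this

lemma XP_pair {n : ℕ} (g : GraphSeed n) (σ τ : Fin n → Bool) (hτ : τ ∈ (BP g σ).erase σ) :
    ∑ ω : Tables n, (XP g σ ω : ℝ) * XP g τ ω ≤ (Fintype.card (Tables n) : ℝ) / 4 ^ n *
      (2 * ((Finset.univ.filter (fun A => (diffS σ τ, A) ∈ pairsG g)).card : ℝ)) := by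
  obtain ⟨hne, hB⟩ := Finset.mem_erase.1 hτ
  obtain ⟨v0, hv0⟩ := (Finset.mem_filter.1 hB).2
  set K : Finset (Fin n) := Finset.univ.filter (fun v => maskG g v τ = maskG g v σ) with hK
  have hv0K : v0 ∈ K := by simp [hK, hv0]
  by_cases hbad : ∃ v ∈ K, σ v ≠ τ v
  · obtain ⟨v, hv, hst⟩ := hbad
    have hv : maskG g v τ = maskG g v σ := by simpa [hK] using hv
    have : ∑ ω : Tables n, (XP g σ ω : ℝ) * XP g τ ω = 0 := by
      apply Finset.sum_eq_zero
      intro ω _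
      by_contra hc
      have h1 : isPNE g ω σ := by
        by_contra h; simp [XP, h] at hc
      have h2 : isPNE g ω τ := by
        by_contra h; simp [XP, h] at hc
      apply hst
      rw [h1 v, h2 v, hv]
    rw [this]; positivity
  push Not at hbad
  have hSne : (diffS σ τ).Nonempty := by
    obtain ⟨v, hv⟩ := Function.ne_iff.1 hne
    exact ⟨v, by simp [diffS, Ne.symm hv]⟩
  have hcard : (Finset.univ.filter (fun A => (diffS σ τ, A) ∈ pairsG g)).card = 2 ^ K.card - 1 := by
    have : Finset.univ.filter (fun A => (diffS σ τ, A) ∈ pairsG g) = K.powerset.erase ∅ := by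
      ext A
      simp only [pairsG, Finset.mem_filter, Finset.mem_univ, true_and, Finset.mem_erase,
        Finset.mem_powerset, hSne, ← Finset.nonempty_iff_ne_empty]
      refine and_congr_right fun _ => ?_
      constructor
      · rintro ⟨_, h⟩ a ha
        simp only [hK, Finset.mem_filter, Finset.mem_univ, true_and]
        exact (mask_eq_iff g a σ τ).2 (h a ha)
      · intro h
        refine ⟨?_, fun a ha => (mask_eq_iff g a σ τ).1 (by simpa [hK] using h ha)⟩
        rw [Finset.disjoint_right]
        intro a ha
        simp [diffS, hbad a (h ha)]
    rw [this, Finset.card_erase_of_mem (by simp), Finset.card_powerset]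
  rw [hcard]
  have hK1 : 1 ≤ K.card := Finset.card_pos.2 ⟨v0, hv0K⟩
  have h2k : (2:ℝ) ^ K.card ≤ 2 * ((2 ^ K.card - 1 : ℕ) : ℝ) := by
    rw [Nat.cast_sub Nat.one_le_two_pow]
    have : (2:ℝ)^1 ≤ 2 ^ K.card := pow_le_pow_right₀ (by norm_num) hK1
    push_cast; linarith
  refine le_trans ?_ (mul_le_mul_of_nonneg_left h2k (by positivity))
  set F : Tables n → ℝ := fun ω => if ∀ v ∈ Kᶜ, τ v = ω v (maskG g v τ) then 1 else 0 with hFdef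
  have h1 : ∑ ω : Tables n, (XP g σ ω : ℝ) * XP g τ ω ≤ ∑ ω : Tables n, (XP g σ ω : ℝ) * F ω := by
    apply Finset.sum_le_sum
    intro ω _
    apply mul_le_mul_of_nonneg_left _ (by positivity)
    by_cases h : isPNE g ω τ
    · have : ∀ v ∈ Kᶜ, τ v = ω v (maskG g v τ) := fun v _ => h v
      simp only [hFdef]
      rw [if_pos this]
      simp [XP, h]
    · simp only [XP, h, if_false, hFdef]
      split_ifs <;> simp
  have h2 := XP_indep g σ F (by
    intro v ω
    simp only [hFdef]
    congr 1
    apply propext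
    refine forall₂_congr fun u hu => ?_
    have : maskG g u τ ≠ maskG g u σ := by simpa [hK] using hu
    by_cases huv : u = v
    · subst huv; simp [flipT, this]
    · simp [flipT, huv])
  have h3 := indep_sum (fun v => maskG g v τ) τ Kᶜ (fun _ => 1) (by simp)
  simp only [mul_one, Finset.sum_const, Finset.card_univ, nsmul_eq_mul] at h3
  have hc : (Kᶜ).card + K.card = n := by
    rw [Finset.card_compl_add_card]; simp
  have h4 : (4:ℝ)^n = 2^n * 2^(Kᶜ).card * 2^K.card := by
    rw [mul_assoc, ← pow_add, hc, ← mul_pow]; norm_num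
  refine h1.trans ?_
  rw [h4, ← h3, div_mul_eq_mul_div, le_div_iff₀ (by positivity)]
  have h2' : ∑ ω, F ω = 2 ^ n * ∑ ω : Tables n, (XP g σ ω : ℝ) * F ω := h2.symm
  simp only [hFdef] at h2' ⊢
  rw [h2']
  apply le_of_eq
  ring

lemma BP_card {n : ℕ} (g : GraphSeed n) (σ : Fin n → Bool) :
    (BP g σ).card ≤ 1 + n + 2 * (pairsG g).card := by
  have h1 : (BP g σ).card = ((BP g σ).image (diffS σ)).card :=
    (Finset.card_image_of_injective _ (diffS_bij σ).1).symm
  have h2 : (BP g σ).image (diffS σ) ⊆ (({∅} ∪ Finset.univ.image (fun v : Fin n => {v})) ∪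
      (pairsG g).image Prod.fst) ∪ (pairsG g).image (fun P => P.1 ∪ P.2) := by
    intro S hS
    obtain ⟨τ, hτ, rfl⟩ := Finset.mem_image.1 hS
    obtain ⟨v, hv⟩ := (Finset.mem_filter.1 hτ).2
    rw [mask_eq_iff] at hv
    generalize diffS σ τ = S at hv
    by_cases hS0 : S = ∅
    · simp [hS0]
    have hne := Finset.nonempty_iff_ne_empty.2 hS0
    by_cases hvS : v ∈ S
    · by_cases hS1 : S = {v}
      · simp [hS1]
      · apply Finset.mem_union_right
        apply Finset.mem_image.2
        refine ⟨(S.erase v, {v}), ?_, ?_⟩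
        · simp only [pairsG, Finset.mem_filter, Finset.mem_univ, true_and]
          refine ⟨?_, by simp, by simp, ?_⟩
          · rw [Finset.nonempty_iff_ne_empty]
            intro h
            rcases (Finset.erase_eq_empty_iff _ _).1 h with h | h
            · exact hS0 h
            · exact hS1 h
          · intro a ha u hu
            rw [Finset.mem_singleton.1 ha]
            exact hv u (Finset.mem_of_mem_erase hu)
        · ext u
          simp only [Finset.mem_union, Finset.mem_erase, Finset.mem_singleton]
          by_cases huv : u = v
          · simp [huv, hvS]
          · simp [huv]
    · apply Finset.mem_union_left
      apply Finset.mem_union_right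
      apply Finset.mem_image.2
      refine ⟨(S, {v}), ?_, rfl⟩
      simp only [pairsG, Finset.mem_filter, Finset.mem_univ, true_and]
      refine ⟨hne, by simp, by simpa using hvS, ?_⟩
      intro a ha u hu
      rw [Finset.mem_singleton.1 ha]
      exact hv u hu
  rw [h1]
  refine (Finset.card_le_card h2).trans ?_
  have a1 := Finset.card_union_le (({∅} ∪ Finset.univ.image (fun v : Fin n => {v})) ∪
      (pairsG g).image Prod.fst) ((pairsG g).image (fun P => P.1 ∪ P.2))
  have a2 := Finset.card_union_le ({∅} ∪ Finset.univ.image (fun v : Fin n => {v}))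
      ((pairsG g).image Prod.fst)
  have a3 := Finset.card_union_le ({∅} : Finset (Finset (Fin n)))
    (Finset.univ.image (fun v : Fin n => {v}))
  have a4 : (Finset.univ.image (fun v : Fin n => ({v} : Finset (Fin n)))).card ≤ n :=
    Finset.card_image_le.trans (by simp)
  have a5 : ((pairsG g).image Prod.fst).card ≤ _ := Finset.card_image_le
  have a6 : ((pairsG g).image (fun P => P.1 ∪ P.2)).card ≤ _ := Finset.card_image_le
  have a7 : ({∅} : Finset (Finset (Fin n))).card = 1 := by simp
  omega

lemma probT_compl {n : ℕ} (A : Tables n → Prop) (Z : Tables n → ℕ) (h : ∀ ω, A ω ↔ Z ω ≠ 0) :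
    probT n A = (∑ ω, (1 - (if Z ω = 0 then (1:ℝ) else 0))) / (Fintype.card (Tables n) : ℝ) := by
  unfold probT
  congr 1
  apply Finset.sum_congr rfl
  intro ω _
  by_cases hA : A ω
  · rw [if_pos hA, if_neg ((h ω).1 hA)]; ring
  · rw [if_neg hA, if_pos (by simpa using (not_congr (h ω)).1 hA)]; ring

lemma game_bound {n : ℕ} (hn : 1 ≤ n) (g : GraphSeed n) :
    |probT n (fun ω => ∃ σ, isPNE g ω σ) - (1 - Real.exp (-1))| ≤
      (1 + n + 4 * (pairsG g).card) / 2 ^ n := by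
  set C : ℝ := (Fintype.card (Tables n) : ℝ) with hC
  have hC0 : 0 < C := by rw [hC]; exact_mod_cast Fintype.card_pos
  have hcs := chen_stein (XP g) (fun σ ω => by unfold XP; split_ifs <;> simp) (BP g)
    (fun σ => by
      simp only [BP, Finset.mem_filter, Finset.mem_univ, true_and]
      exact ⟨⟨0, hn⟩, trivial⟩)
    (fun σ h => by
      have := XP_indep g σ (fun ω => h (∑ j ∈ (BP g σ)ᶜ, XP g j ω)) (by
        intro v ω
        congr 1
        apply Finset.sum_congr rfl
        intro j hj
        have hj' : ∀ u, maskG g u j ≠ maskG g u σ := by simpa [BP] using hj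
        have : isPNE g (flipT v (maskG g v σ) ω) j ↔ isPNE g ω j := by
          unfold isPNE
          refine forall_congr' fun u => ?_
          by_cases huv : u = v
          · subst huv; simp [flipT, hj']
          · simp [flipT, huv]
        simp [XP, this])
      rw [← this]
      simp)
  have hcard : (Fintype.card (Fin n → Bool) : ℝ) = 2 ^ n := by simp
  rw [hcard] at hcs
  have b1 : (∑ i, ∑ j ∈ BP g i, ∑ ω, (XP g j ω : ℝ)) / (2:ℝ) ^ n ≤
      C * ((1 + n + 2 * (pairsG g).card) / 2 ^ n) := by
    have : ∑ i, ∑ j ∈ BP g i, ∑ ω, (XP g j ω : ℝ) ≤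
        ∑ i : Fin n → Bool, (1 + n + 2 * (pairsG g).card) * (C / 2 ^ n) := by
      apply Finset.sum_le_sum
      intro σ _
      simp only [XP_mean, Finset.sum_const, nsmul_eq_mul]
      apply mul_le_mul_of_nonneg_right _ (by positivity)
      exact_mod_cast BP_card g σ
    rw [Finset.sum_const, Finset.card_univ, nsmul_eq_mul, hcard] at this
    rw [div_le_iff₀ (by positivity)]
    refine this.trans (le_of_eq ?_)
    field_simp
  have b2 : ∑ i, ∑ j ∈ (BP g i).erase i, ∑ ω, (XP g i ω : ℝ) * XP g j ω ≤
      C * (2 * (pairsG g).card / 2 ^ n) := by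
    have : ∑ i, ∑ j ∈ (BP g i).erase i, ∑ ω, (XP g i ω : ℝ) * XP g j ω ≤
        ∑ i : Fin n → Bool, C / 4 ^ n * (2 * (pairsG g).card) := by
      apply Finset.sum_le_sum
      intro σ _
      refine (Finset.sum_le_sum (fun τ hτ => XP_pair g σ τ hτ)).trans ?_
      rw [← Finset.mul_sum, ← Finset.mul_sum]
      gcongr
      refine (Finset.sum_le_sum_of_subset_of_nonneg (Finset.subset_univ _)
        (fun _ _ _ => by positivity)).trans ?_
      rw [(diffS_bij σ).sum_comp
        (fun S => ((Finset.univ.filter (fun A => (S, A) ∈ pairsG g)).card : ℝ))]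
      rw [← Nat.cast_sum]
      norm_cast
      rw [Finset.card_eq_sum_card_fiberwise (f := Prod.fst) (t := Finset.univ) (by simp)]
      apply Finset.sum_le_sum
      intro S _
      apply Finset.card_le_card_of_injOn (fun A => (S, A))
      · intro A hA
        simpa using hA
      · intro A _ A' _ h
        simpa using h
    rw [Finset.sum_const, Finset.card_univ, nsmul_eq_mul, hcard] at this
    refine this.trans (le_of_eq ?_)
    have : (4:ℝ)^n = 2^n*2^n := by rw [← mul_pow]; norm_num
    rw [this]
    field_simp
  have e : probT n (fun ω => ∃ σ, isPNE g ω σ) - (1 - Real.exp (-1)) =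
      -(∑ ω, ((if ∑ i, XP g i ω = 0 then (1:ℝ) else 0) - Real.exp (-1))) / C := by
    rw [probT_compl _ (fun ω => ∑ i, XP g i ω) (fun ω => by simp [XP])]
    rw [eq_div_iff hC0.ne', sub_mul, div_mul_cancel₀ _ hC0.ne', Finset.sum_sub_distrib]
    rw [Finset.sum_sub_distrib]
    simp only [Finset.sum_const, Finset.card_univ, nsmul_eq_mul]
    rw [← hC]
    ring
  rw [e, abs_div, abs_neg, abs_of_pos hC0, div_le_iff₀ hC0]
  refine (hcs.trans (add_le_add b1 b2)).trans (le_of_eq ?_)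
  ring

lemma sum_prod_seed {n : ℕ} (f : EdgePair n → Bool → ℝ) :
    ∑ g : GraphSeed n, ∏ e, f e (g e) = ∏ e, (f e true + f e false) := by
  have := Finset.prod_univ_sum (fun _ : EdgePair n => (Finset.univ : Finset Bool)) f
  simp only [Fintype.piFinset_univ, Fintype.sum_bool] at this
  exact this.symm

lemma graphWeight_sum {n : ℕ} (p : ℝ) : ∑ g : GraphSeed n, graphWeight p g = 1 := by
  unfold graphWeight
  rw [sum_prod_seed (fun _ b => if b then p else 1 - p)]
  simp

lemma graphWeight_nonneg {n : ℕ} {p : ℝ} (h0 : 0 ≤ p) (h1 : p ≤ 1) (g : GraphSeed n) :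
    0 ≤ graphWeight p g := by
  unfold graphWeight
  apply Finset.prod_nonneg
  intro e _
  split_ifs <;> linarith

lemma noedge_prob {n : ℕ} {p : ℝ} (h0 : 0 ≤ p) (h1 : p ≤ 1) (S A : Finset (Fin n))
    (hd : Disjoint S A) :
    ∑ g : GraphSeed n, graphWeight p g *
      (if ∀ a ∈ A, ∀ u ∈ S, adjB g a u = false then 1 else 0) ≤ (1 - p) ^ (S.card * A.card) := by
  set E : Finset (EdgePair n) := Finset.univ.filter
    (fun e => (e.1.1 ∈ A ∧ e.1.2 ∈ S) ∨ (e.1.1 ∈ S ∧ e.1.2 ∈ A)) with hE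
  have hcard : S.card * A.card ≤ E.card := by
    rw [mul_comm, ← Finset.card_product]
    apply Finset.card_le_card_of_surjOn
      (fun e : EdgePair n => if e.1.1 ∈ A then (e.1.1, e.1.2) else (e.1.2, e.1.1))
    rintro ⟨a, u⟩ hau
    simp only [Finset.coe_product, Set.mem_prod, Finset.mem_coe] at hau
    have hne : a ≠ u := fun h => Finset.disjoint_left.1 hd hau.2 (h ▸ hau.1)
    rcases lt_or_gt_of_ne hne with h | h
    · exact ⟨⟨(a, u), h⟩, by simp [hE, hau], by simp [hau]⟩
    · exact ⟨⟨(u, a), h⟩, by simp [hE, hau], by simp [Finset.disjoint_left.1 hd hau.2]⟩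
  have h2 : ∀ g : GraphSeed n, graphWeight p g *
      (if ∀ a ∈ A, ∀ u ∈ S, adjB g a u = false then 1 else 0) ≤
      ∏ e, ((if g e then p else 1 - p) * (if e ∈ E ∧ g e = true then 0 else 1)) := by
    intro g
    rw [Finset.prod_mul_distrib]
    apply mul_le_mul_of_nonneg_left _ (graphWeight_nonneg h0 h1 g)
    by_cases h : ∀ a ∈ A, ∀ u ∈ S, adjB g a u = false
    · rw [if_pos h, Finset.prod_eq_one]
      intro e _
      rw [if_neg]
      rintro ⟨he, hg⟩
      obtain ⟨⟨i, j⟩, hij⟩ := e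
      simp only [hE, Finset.mem_filter, Finset.mem_univ, true_and] at he
      rcases he with he | he
      · have := h _ he.1 _ he.2
        have hij' : i < j := hij
        simp [adjB, hij', hg] at this
      · have := h _ he.2 _ he.1
        have hij' : i < j := hij
        simp [adjB, hij', hij'.asymm, hg] at this
    · rw [if_neg h]
      apply Finset.prod_nonneg
      intro e _
      split_ifs <;> simp
  refine (Finset.sum_le_sum (fun g _ => h2 g)).trans ?_
  rw [sum_prod_seed (fun e b => (if b then p else 1 - p) * (if e ∈ E ∧ b = true then 0 else 1))]
  have h3 : ∀ e : EdgePair n, (((if true then p else 1 - p) * (if e ∈ E ∧ true = true then 0 else 1)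
      + (if false = true then p else 1 - p) * (if e ∈ E ∧ false = true then 0 else 1)) : ℝ) =
      if e ∈ E then 1 - p else 1 := by
    intro e
    by_cases he : e ∈ E <;> simp [he]
  have h4 : ∏ e : EdgePair n, (((if true then p else 1 - p) * (if e ∈ E ∧ true = true then 0 else 1)
      + (if false = true then p else 1 - p) * (if e ∈ E ∧ false = true then 0 else 1)) : ℝ) =
      (1 - p) ^ E.card := by
    rw [Finset.prod_congr rfl (fun e _ => h3 e)]
    simp
  refine (le_of_eq h4).trans ?_
  exact pow_le_pow_of_le_one (by linarith) (by linarith) hcard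

/-- Expected number of pairs. -/
noncomputable def WW (n : ℕ) (q : ℝ) : ℝ :=
  ∑ P ∈ Finset.univ.filter (fun P : Finset (Fin n) × Finset (Fin n) =>
    P.1.Nonempty ∧ P.2.Nonempty ∧ Disjoint P.1 P.2), q ^ (P.1.card * P.2.card)

lemma EW_le {n : ℕ} {p : ℝ} (h0 : 0 ≤ p) (h1 : p ≤ 1) :
    ∑ g : GraphSeed n, graphWeight p g * ((pairsG g).card : ℝ) ≤ WW n (1 - p) := by
  have e : ∀ g : GraphSeed n, ((pairsG g).card : ℝ) =
      ∑ P ∈ Finset.univ.filter (fun P : Finset (Fin n) × Finset (Fin n) =>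
        P.1.Nonempty ∧ P.2.Nonempty ∧ Disjoint P.1 P.2),
        (if ∀ a ∈ P.2, ∀ u ∈ P.1, adjB g a u = false then 1 else 0) := by
    intro g
    rw [Finset.sum_boole, Finset.filter_filter]
    congr 2
    unfold pairsG
    apply Finset.filter_congr
    intro P _
    tauto
  simp only [e, Finset.mul_sum]
  rw [Finset.sum_comm]
  unfold WW
  apply Finset.sum_le_sum
  intro P hP
  exact noedge_prob h0 h1 _ _ (Finset.mem_filter.1 hP).2.2.2

lemma main_bound {n : ℕ} {p : ℝ} (hn : 1 ≤ n) (h0 : 0 ≤ p) (h1 : p ≤ 1) :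
    |probGT n p (fun g ω => ∃ σ, isPNE g ω σ) - (1 - Real.exp (-1))| ≤
      (1 + n) / 2 ^ n + 4 * (WW n (1 - p) / 2 ^ n) := by
  have e : probGT n p (fun g ω => ∃ σ, isPNE g ω σ) - (1 - Real.exp (-1)) =
      ∑ g : GraphSeed n, graphWeight p g *
        (probT n (fun ω => ∃ σ, isPNE g ω σ) - (1 - Real.exp (-1))) := by
    simp only [mul_sub, Finset.sum_sub_distrib, ← Finset.sum_mul, graphWeight_sum]
    unfold probGT
    ring
  rw [e]
  refine (Finset.abs_sum_le_sum_abs _ _).trans ?_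
  have : ∀ g : GraphSeed n, |graphWeight p g *
        (probT n (fun ω => ∃ σ, isPNE g ω σ) - (1 - Real.exp (-1)))| ≤
        graphWeight p g * ((1 + n) / 2 ^ n) + 4 / 2 ^ n * (graphWeight p g * (pairsG g).card) := by
    intro g
    rw [abs_mul, abs_of_nonneg (graphWeight_nonneg h0 h1 g)]
    refine (mul_le_mul_of_nonneg_left (game_bound hn g) (graphWeight_nonneg h0 h1 g)).trans ?_
    apply le_of_eq; ring
  refine (Finset.sum_le_sum (fun g _ => this g)).trans ?_
  rw [Finset.sum_add_distrib, ← Finset.sum_mul, graphWeight_sum, ← Finset.mul_sum, one_mul]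
  have h2 := mul_le_mul_of_nonneg_left (EW_le (n := n) h0 h1)
    (show (0:ℝ) ≤ 4 / 2 ^ n by positivity)
  have h3 : 4 * (WW n (1 - p) / 2 ^ n) = 4 / 2 ^ n * WW n (1 - p) := by ring
  rw [h3]
  linarith

/-- One-sided inner sum. -/
noncomputable def innerW (n : ℕ) (q : ℝ) (S : Finset (Fin n)) : ℝ :=
  ∑ A ∈ Sᶜ.powerset.filter (fun A => S.card ≤ A.card), q ^ (S.card * A.card)

lemma WW_le_inner (n : ℕ) (q : ℝ) (hq : 0 ≤ q) :
    WW n q ≤ 2 * ∑ S ∈ (Finset.univ : Finset (Finset (Fin n))).erase ∅, innerW n q S := by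
  have key : ∑ S ∈ (Finset.univ : Finset (Finset (Fin n))).erase ∅, innerW n q S =
      ∑ P ∈ Finset.univ.filter (fun P : Finset (Fin n) × Finset (Fin n) =>
      P.1.Nonempty ∧ Disjoint P.1 P.2 ∧ P.1.card ≤ P.2.card), q ^ (P.1.card * P.2.card) := by
    unfold innerW
    rw [Finset.sum_sigma']
    refine Finset.sum_bij' (fun x _ => (x.1, x.2)) (fun P _ => ⟨P.1, P.2⟩) ?_ ?_ ?_ ?_ ?_
    · rintro ⟨S, A⟩ h
      simp only [Finset.mem_sigma, Finset.mem_erase, Finset.mem_filter, Finset.mem_powerset,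
        Finset.mem_univ, and_true, true_and, ← Finset.nonempty_iff_ne_empty,
        Finset.subset_compl_iff_disjoint_left] at h ⊢
      tauto
    · rintro ⟨S, A⟩ h
      simp only [Finset.mem_sigma, Finset.mem_erase, Finset.mem_filter, Finset.mem_powerset,
        Finset.mem_univ, and_true, true_and, ← Finset.nonempty_iff_ne_empty,
        Finset.subset_compl_iff_disjoint_left] at h ⊢
      tauto
    · rintro ⟨S, A⟩ h; rfl
    · rintro ⟨S, A⟩ h; rfl
    · rintro ⟨S, A⟩ h; rfl
  set T := Finset.univ.filter (fun P : Finset (Fin n) × Finset (Fin n) =>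
      P.1.Nonempty ∧ Disjoint P.1 P.2 ∧ P.1.card ≤ P.2.card) with hT
  have hsub : (Finset.univ.filter (fun P : Finset (Fin n) × Finset (Fin n) =>
      P.1.Nonempty ∧ P.2.Nonempty ∧ Disjoint P.1 P.2)) ⊆ T ∪ T.image Prod.swap := by
    rintro ⟨S, A⟩ h
    simp only [Finset.mem_filter, Finset.mem_univ, true_and] at h
    rcases le_total S.card A.card with h' | h'
    · apply Finset.mem_union_left
      simp [hT, h, h']
    · apply Finset.mem_union_right
      exact Finset.mem_image.2 ⟨(A, S), by simp [hT, h, h', h.2.2.symm], rfl⟩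
  unfold WW
  refine (Finset.sum_le_sum_of_subset_of_nonneg hsub (fun _ _ _ => by positivity)).trans ?_
  have hu := Finset.sum_union_inter (s₁ := T) (s₂ := T.image Prod.swap)
    (f := fun P : Finset (Fin n) × Finset (Fin n) => q ^ (P.1.card * P.2.card))
  have hpos : 0 ≤ ∑ P ∈ T ∩ T.image Prod.swap, q ^ (P.1.card * P.2.card) :=
    Finset.sum_nonneg (fun _ _ => by positivity)
  have him : ∑ P ∈ T.image Prod.swap, q ^ (P.1.card * P.2.card) =
      ∑ P ∈ T, q ^ (P.1.card * P.2.card) := by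
    rw [Finset.sum_image (fun a _ b _ h => Prod.swap_injective h)]
    apply Finset.sum_congr rfl
    intro P _
    simp [mul_comm]
  rw [key]
  linarith

lemma innerW_le (n : ℕ) (q : ℝ) (hq : 0 ≤ q) (S : Finset (Fin n)) :
    innerW n q S ≤ (1 + q ^ S.card) ^ (n - S.card) := by
  unfold innerW
  refine (Finset.sum_le_sum_of_subset_of_nonneg (Finset.filter_subset _ _)
    (fun _ _ _ => by positivity)).trans ?_
  have := Finset.sum_pow_mul_eq_add_pow (q ^ S.card) 1 Sᶜ
  rw [Finset.card_compl, Fintype.card_fin, add_comm] at this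
  rw [← this]
  apply le_of_eq
  apply Finset.sum_congr rfl
  intro A _
  rw [one_pow, mul_one, pow_mul]

lemma innerW_le' (n : ℕ) (q R : ℝ) (hR : 0 ≤ R) (S : Finset (Fin n))
    (h : ∀ k, S.card ≤ k → q ^ (S.card * k) ≤ R) :
    innerW n q S ≤ 2 ^ n * R := by
  unfold innerW
  refine (Finset.sum_le_card_nsmul _ _ R (fun A hA => h _ (Finset.mem_filter.1 hA).2)).trans ?_
  rw [nsmul_eq_mul]
  gcongr
  have : (Finset.filter (fun A => S.card ≤ A.card) Sᶜ.powerset).card ≤ 2 ^ n := by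
    refine (Finset.card_le_univ _).trans ?_
    simp
  exact_mod_cast this

lemma WW_bound (n : ℕ) (q y r x z R : ℝ) (hq : 0 ≤ q) (hy : 0 ≤ y) (hr : 0 ≤ r) (hx : 0 ≤ x)
    (hz : 0 ≤ z) (hR : 0 ≤ R)
    (h : ∀ s : ℕ, 1 ≤ s → s ≤ n →
      ((1 + q ^ s) ^ (n - s) / 2 ^ n ≤ y ^ s + z * ((x / 2) ^ s * r ^ (n - s))) ∨
      (∀ k, s ≤ k → q ^ (s * k) ≤ R)) :
    WW n q / 2 ^ n ≤ 2 * (((1 + y) ^ n - 1) + z * (x / 2 + r) ^ n + 2 ^ n * R) := by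
  have hS : ∀ S ∈ (Finset.univ : Finset (Finset (Fin n))).erase ∅, innerW n q S / 2 ^ n ≤
      y ^ S.card + z * ((x / 2) ^ S.card * r ^ (n - S.card)) + R := by
    intro S hS
    have h1 : 1 ≤ S.card := Finset.card_pos.2 (Finset.nonempty_iff_ne_empty.2 (Finset.ne_of_mem_erase hS))
    have h2 : S.card ≤ n := by simpa using Finset.card_le_univ S
    rcases h _ h1 h2 with h3 | h3
    · have : innerW n q S / 2 ^ n ≤ (1 + q ^ S.card) ^ (n - S.card) / 2 ^ n := by
        gcongr; exact innerW_le n q hq S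
      linarith
    · have : innerW n q S / 2 ^ n ≤ R := by
        rw [div_le_iff₀ (by positivity), mul_comm]
        exact innerW_le' n q R hR S h3
      have : 0 ≤ y ^ S.card + z * ((x / 2) ^ S.card * r ^ (n - S.card)) := by positivity
      linarith
  have s1 : ∑ S ∈ (Finset.univ : Finset (Finset (Fin n))).erase ∅, y ^ S.card = (1 + y) ^ n - 1 := by
    have a := Fintype.sum_pow_mul_eq_add_pow (Fin n) y 1
    have b := Finset.add_sum_erase Finset.univ (fun S : Finset (Fin n) => y ^ S.card)
      (Finset.mem_univ ∅)
    simp only [Finset.card_empty, pow_zero] at b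
    simp only [one_pow, mul_one, Fintype.card_fin] at a
    rw [add_comm 1 y]
    linarith
  have s2 : ∑ S ∈ (Finset.univ : Finset (Finset (Fin n))).erase ∅,
      z * ((x / 2) ^ S.card * r ^ (n - S.card)) ≤ z * (x / 2 + r) ^ n := by
    rw [← Finset.mul_sum]
    gcongr
    have a := Fintype.sum_pow_mul_eq_add_pow (Fin n) (x / 2) r
    rw [Fintype.card_fin] at a
    rw [← a]
    exact Finset.sum_le_sum_of_subset_of_nonneg (Finset.erase_subset _ _)
      (fun _ _ _ => by positivity)
  have s3 : ∑ S ∈ (Finset.univ : Finset (Finset (Fin n))).erase ∅, R ≤ 2 ^ n * R := by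
    rw [Finset.sum_const, nsmul_eq_mul]
    gcongr
    have : ((Finset.univ : Finset (Finset (Fin n))).erase ∅).card ≤ 2 ^ n :=
      (Finset.card_le_univ _).trans (by simp)
    exact_mod_cast this
  have s4 := Finset.sum_le_sum hS
  rw [← Finset.sum_div, Finset.sum_add_distrib, Finset.sum_add_distrib, s1] at s4
  have s5 : WW n q / 2 ^ n ≤
      2 * ((∑ S ∈ (Finset.univ : Finset (Finset (Fin n))).erase ∅, innerW n q S) / 2 ^ n) := by
    rw [← mul_div_assoc]
    gcongr
    exact WW_le_inner n q hq
  linarith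

lemma regime (ε δ r x a b L p : ℝ) (n s : ℕ) (hε : 0 < ε) (hδ : 0 < δ) (hδ1 : δ ≤ 1)
    (hδε : (1 + ε / 4) * (1 + δ) ≤ (1 + ε / 2) * (1 - δ))
    (hr : 1 + Real.exp (-δ) = 2 * r) (hx : x = Real.exp (-a)) (ha : 0 < a) (hb : 0 < b)
    (hn : 1 ≤ n) (hL : 1 ≤ L) (hp : p * n = (2 + ε) * L) (hp1 : p ≤ 1) (hsn : s ≤ n) :
    ((1 + (1 - p) ^ s) ^ (n - s) / 2 ^ n ≤ (Real.exp (-((1 + ε / 4) * L))) ^ s +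
      Real.exp (b * n) * ((x / 2) ^ s * r ^ (n - s))) ∨
      (∀ k, s ≤ k → (1 - p) ^ (s * k) ≤ Real.exp (-((2 + ε) * (b / a) ^ 2 * L * n))) := by
  have hn' : (1:ℝ) ≤ n := by exact_mod_cast hn
  have hp0 : 0 < p := by
    by_contra h
    have : p * n ≤ 0 := mul_nonpos_of_nonpos_of_nonneg (by linarith) (by linarith)
    nlinarith
  have hq0 : 0 ≤ 1 - p := by linarith
  have hq : ∀ m : ℕ, (1 - p) ^ m ≤ Real.exp (-(p * m)) := by
    intro m
    have : 1 - p ≤ Real.exp (-p) := by linarith [Real.add_one_le_exp (-p)]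
    calc (1 - p) ^ m ≤ (Real.exp (-p)) ^ m := by gcongr
      _ = _ := by rw [← Real.exp_nat_mul]; congr 1; ring
  have hr0 : 0 < r := by linarith [Real.exp_pos (-δ)]
  have hx0 : 0 < x := by rw [hx]; exact Real.exp_pos _
  have hs0 : (0:ℝ) ≤ s := by positivity
  have hsn' : (s:ℝ) ≤ n := by exact_mod_cast hsn
  have hcast : ((n - s : ℕ) : ℝ) = n - s := by push_cast [hsn]; ring
  by_cases h1 : p * s ≤ δ
  · left
    have hpos : 0 ≤ Real.exp (b * n) * ((x / 2) ^ s * r ^ (n - s)) := by positivity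
    suffices (1 + (1 - p) ^ s) ^ (n - s) / 2 ^ n ≤ (Real.exp (-((1 + ε / 4) * L))) ^ s by linarith
    set u := (1 - p) ^ s with hu
    have hu0 : 0 ≤ u := by positivity
    have hps : 0 ≤ p * s := by positivity
    have hu1 : p * s / (1 + δ) ≤ 1 - u := by
      have e1 : u * (1 + p * s) ≤ 1 := by
        have h2 : 1 + p * s ≤ Real.exp (p * s) := by linarith [Real.add_one_le_exp (p * s)]
        calc u * (1 + p * s) ≤ Real.exp (-(p * s)) * Real.exp (p * s) := by
              gcongr; exact hq s
          _ = 1 := by rw [← Real.exp_add]; simp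
      rw [div_le_iff₀ (by linarith)]
      have hu2 : u ≤ 1 := pow_le_one₀ hq0 (by linarith)
      nlinarith
    have e2 : 1 + u ≤ 2 * Real.exp (-((1 - u) / 2)) := by
      linarith [Real.add_one_le_exp (-((1 - u) / 2))]
    rw [div_le_iff₀ (by positivity)]
    have e3 : (1 + u) ^ (n - s) ≤ 2 ^ n * Real.exp (-((1 - u) / 2)) ^ (n - s) := by
      calc (1 + u) ^ (n - s) ≤ (2 * Real.exp (-((1 - u) / 2))) ^ (n - s) := by gcongr
        _ = 2 ^ (n - s) * Real.exp (-((1 - u) / 2)) ^ (n - s) := mul_pow _ _ _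
        _ ≤ _ := by
          gcongr
          · norm_num
          · omega
    refine e3.trans ?_
    rw [mul_comm]
    gcongr
    rw [← Real.exp_nat_mul, ← Real.exp_nat_mul, hcast]
    apply Real.exp_le_exp.2
    have hsd : (s:ℝ) ≤ δ * n := by
      have : p * n * s ≤ δ * n := by nlinarith
      rw [hp] at this
      nlinarith [mul_nonneg hs0 (by linarith : 0 ≤ L), mul_nonneg (mul_nonneg hε.le (by linarith : 0 ≤ L)) hs0]
    have e4 : n * (1 - δ) * (p * s / (1 + δ)) ≤ (n - s) * (1 - u) := by
      apply mul_le_mul _ hu1 (by positivity) (by linarith)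
      linarith
    have e5 : n * (1 - δ) * (p * s / (1 + δ)) = 2 * (L * s) * ((1 + ε / 2) * (1 - δ) / (1 + δ)) := by
      have : n * (1 - δ) * (p * s / (1 + δ)) = (p * n) * (s * (1 - δ) / (1 + δ)) := by ring
      rw [this, hp]; ring
    have e6 : 1 + ε / 4 ≤ (1 + ε / 2) * (1 - δ) / (1 + δ) := by
      rw [le_div_iff₀ (by linarith)]; exact hδε
    have e7 : 2 * (L * s) * (1 + ε / 4) ≤ 2 * (L * s) * ((1 + ε / 2) * (1 - δ) / (1 + δ)) := by
      gcongr
    nlinarith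
  push Not at h1
  by_cases h2 : a * s ≤ b * n
  · left
    have hpos : 0 ≤ (Real.exp (-((1 + ε / 4) * L))) ^ s := by positivity
    suffices (1 + (1 - p) ^ s) ^ (n - s) / 2 ^ n ≤
      Real.exp (b * n) * ((x / 2) ^ s * r ^ (n - s)) by linarith
    have e1 : 1 + (1 - p) ^ s ≤ 2 * r := by
      rw [← hr]
      have := (hq s).trans (Real.exp_le_exp.2 (by linarith : -(p * s) ≤ -δ))
      linarith
    have e2 : (1 + (1 - p) ^ s) ^ (n - s) ≤ (2 * r) ^ (n - s) := by
      have : 0 ≤ (1 - p) ^ s := by positivity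
      gcongr
    have e3 : (2 * r) ^ (n - s) / 2 ^ n = (1 / 2) ^ s * r ^ (n - s) := by
      have : (2:ℝ) ^ n = 2 ^ s * 2 ^ (n - s) := by rw [← pow_add]; congr 1; omega
      rw [this, mul_pow, div_pow, one_pow]
      field_simp
    have e4 : 1 ≤ Real.exp (b * n) * x ^ s := by
      rw [hx, ← Real.exp_nat_mul, ← Real.exp_add]
      apply Real.one_le_exp
      linarith
    calc _ ≤ (2 * r) ^ (n - s) / 2 ^ n := by gcongr
      _ = 1 * ((1 / 2) ^ s * r ^ (n - s)) := by rw [e3, one_mul]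
      _ ≤ (Real.exp (b * n) * x ^ s) * ((1 / 2) ^ s * r ^ (n - s)) := by gcongr
      _ = _ := by rw [div_pow, div_pow]; ring
  · right
    push Not at h2
    intro k hk
    refine (hq _).trans (Real.exp_le_exp.2 ?_)
    have hk' : (s:ℝ) ≤ k := by exact_mod_cast hk
    have g1 : b / a * n ≤ s := by
      rw [div_mul_eq_mul_div, div_le_iff₀ ha]; linarith
    have g2 : (b / a * n) * (b / a * n) ≤ s * k :=
      mul_le_mul g1 (g1.trans hk') (by positivity) hs0
    have g3 := mul_le_mul_of_nonneg_left g2 hp0.le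
    have g4 : p * (b / a * n * (b / a * n)) = (2 + ε) * (b / a) ^ 2 * L * n := by
      have : p * (b / a * n * (b / a * n)) = (p * n) * ((b / a) ^ 2 * n) := by ring
      rw [this, hp]; ring
    push_cast
    linarith

lemma WW_tendsto (ε : ℝ) (hε : 0 < ε) :
    ∃ U : ℕ → ℝ, Filter.Tendsto U Filter.atTop (nhds 0) ∧
      ∀ᶠ n : ℕ in Filter.atTop, 1 ≤ n ∧ 0 ≤ (2 + ε) * Real.log n / n ∧
        (2 + ε) * Real.log n / n ≤ 1 ∧
        WW n (1 - (2 + ε) * Real.log n / n) / 2 ^ n ≤ U n := by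
  obtain ⟨δ, hδ, hδ1, hδε⟩ : ∃ δ : ℝ, 0 < δ ∧ δ ≤ 1 ∧
      (1 + ε / 4) * (1 + δ) ≤ (1 + ε / 2) * (1 - δ) := by
    refine ⟨ε / (8 + 3 * ε), by positivity, ?_, ?_⟩
    · rw [div_le_one (by positivity)]; linarith
    · apply le_of_eq; field_simp; ring
  obtain ⟨r, hr⟩ : ∃ r, 1 + Real.exp (-δ) = 2 * r := ⟨(1 + Real.exp (-δ)) / 2, by ring⟩
  have hexp1 : Real.exp (-δ) < 1 := by rw [← Real.exp_zero]; exact Real.exp_lt_exp.2 (by linarith)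
  have hr0 : 0 < r := by linarith [Real.exp_pos (-δ)]
  have hr1 : r < 1 := by linarith
  obtain ⟨a, ha⟩ : ∃ a, a = -Real.log (1 - r) := ⟨_, rfl⟩
  obtain ⟨b, hb⟩ : ∃ b, b = -Real.log ((1 + r) / 2) / 2 := ⟨_, rfl⟩
  have ha0 : 0 < a := by
    rw [ha]; linarith [Real.log_neg (by linarith : 0 < 1 - r) (by linarith)]
  have hb0 : 0 < b := by
    rw [hb]; linarith [Real.log_neg (by linarith : 0 < (1 + r) / 2) (by linarith)]
  have hxa : 1 - r = Real.exp (-a) := by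
    rw [ha, neg_neg, Real.exp_log (by linarith)]
  have hrb : (1 - r) / 2 + r = Real.exp (-(2 * b)) := by
    rw [hb, show -(2 * (-Real.log ((1 + r) / 2) / 2)) = Real.log ((1 + r) / 2) by ring,
      Real.exp_log (by linarith)]
    ring
  have hlog : Filter.Tendsto (fun n : ℕ => Real.log n) Filter.atTop Filter.atTop :=
    Real.tendsto_log_atTop.comp tendsto_natCast_atTop_atTop
  have hdiv : Filter.Tendsto (fun n : ℕ => (2 + ε) * Real.log n / n) Filter.atTop (nhds 0) := by
    have h := (Real.isLittleO_log_id_atTop.tendsto_div_nhds_zero).comp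
      (tendsto_natCast_atTop_atTop (R := ℝ))
    have h' := h.const_mul (2 + ε)
    rw [mul_zero] at h'
    refine h'.congr fun n => ?_
    simp [mul_div_assoc]
  refine ⟨fun n => 2 * ((Real.exp (Real.exp (-((ε / 4) * Real.log n))) - 1) + Real.exp (-(b * n)) +
    Real.exp (-(n : ℝ))), ?_, ?_⟩
  · have t1 : Filter.Tendsto (fun n : ℕ => Real.exp (-((ε / 4) * Real.log n)))
        Filter.atTop (nhds 0) := by
      apply Real.tendsto_exp_neg_atTop_nhds_zero.comp
      exact hlog.const_mul_atTop (by positivity)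
    have t1' : Filter.Tendsto (fun n : ℕ => Real.exp (Real.exp (-((ε / 4) * Real.log n))))
        Filter.atTop (nhds 1) := by
      have := (Real.continuous_exp.tendsto 0).comp t1
      rw [Real.exp_zero] at this
      exact this
    have t2 : Filter.Tendsto (fun n : ℕ => Real.exp (-(b * n))) Filter.atTop (nhds 0) := by
      apply Real.tendsto_exp_neg_atTop_nhds_zero.comp
      exact tendsto_natCast_atTop_atTop.const_mul_atTop hb0
    have t3 : Filter.Tendsto (fun n : ℕ => Real.exp (-(n:ℝ))) Filter.atTop (nhds 0) :=
      Real.tendsto_exp_neg_atTop_nhds_zero.comp tendsto_natCast_atTop_atTop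
    have := (((t1'.sub_const 1).add t2).add t3).const_mul 2
    simpa using this
  · filter_upwards [Filter.eventually_ge_atTop 1, hlog.eventually_ge_atTop 1,
      hdiv.eventually_le_const (by norm_num : (0:ℝ) < 1),
      hlog.eventually_ge_atTop (2 / ((2 + ε) * (b / a) ^ 2))] with n hn hL hp1 hL2
    have hn0 : (0:ℝ) < n := by exact_mod_cast hn
    have hc : 0 < (2 + ε) * (b / a) ^ 2 := by positivity
    refine ⟨hn, div_nonneg (mul_nonneg (by linarith) (by linarith)) hn0.le, hp1, ?_⟩
    have hp : (2 + ε) * Real.log n / n * n = (2 + ε) * Real.log n := by field_simp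
    set L := Real.log n with hLdef
    set p := (2 + ε) * L / n with hpdef
    have key := WW_bound n (1 - p) (Real.exp (-((1 + ε / 4) * L))) r (1 - r) (Real.exp (b * n))
      (Real.exp (-((2 + ε) * (b / a) ^ 2 * L * n))) (by linarith) (by positivity) hr0.le
      (by linarith) (by positivity) (by positivity)
      (fun s _ hs => regime ε δ r (1 - r) a b L p n s hε hδ hδ1 hδε hr hxa ha0 hb0 hn hL hp hp1 hs)
    refine key.trans ?_
    have k1 : (1 + Real.exp (-((1 + ε / 4) * L))) ^ n ≤ Real.exp (Real.exp (-((ε / 4) * L))) := by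
      have : 1 + Real.exp (-((1 + ε / 4) * L)) ≤ Real.exp (Real.exp (-((1 + ε / 4) * L))) := by
        linarith [Real.add_one_le_exp (Real.exp (-((1 + ε / 4) * L)))]
      calc _ ≤ (Real.exp (Real.exp (-((1 + ε / 4) * L)))) ^ n := by gcongr
        _ = _ := by
          rw [← Real.exp_nat_mul]
          congr 1
          nth_rewrite 1 [← Real.exp_log hn0]
          rw [← hLdef, ← Real.exp_add]
          congr 1; ring
    have k2 : Real.exp (b * n) * ((1 - r) / 2 + r) ^ n = Real.exp (-(b * n)) := by
      rw [hrb, ← Real.exp_nat_mul, ← Real.exp_add]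
      congr 1; ring
    have k3 : 2 ^ n * Real.exp (-((2 + ε) * (b / a) ^ 2 * L * n)) ≤ Real.exp (-(n:ℝ)) := by
      have h2 : (2:ℝ) ≤ Real.exp 1 := by linarith [Real.add_one_le_exp (1:ℝ)]
      calc _ ≤ (Real.exp 1) ^ n * Real.exp (-((2 + ε) * (b / a) ^ 2 * L * n)) := by gcongr
        _ ≤ _ := by
          rw [← Real.exp_nat_mul, ← Real.exp_add]
          apply Real.exp_le_exp.2
          rw [div_le_iff₀ hc] at hL2
          have := mul_le_mul_of_nonneg_right hL2 hn0.le
          linarith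
    linarith

/-- **High connectivity, existence.** For `p = (2+ε) log n / n`, the probability under
the random `G(n,p)`-game measure that a pure Nash equilibrium exists converges to
`1 - 1/e` as `n → ∞`. -/
theorem stmt1 (ε : ℝ) (hε : 0 < ε) :
    Filter.Tendsto
      (fun n : ℕ => probGT n ((2 + ε) * Real.log n / n) (fun g ω => ∃ σ, isPNE g ω σ))
      Filter.atTop (nhds (1 - Real.exp (-1))) := by
  obtain ⟨U, hU, hev⟩ := WW_tendsto ε hε
  rw [tendsto_iff_dist_tendsto_zero]
  have h1 : Filter.Tendsto (fun n : ℕ => (1 + (n:ℝ)) / 2 ^ n) Filter.atTop (nhds 0) := by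
    have a := tendsto_pow_const_div_const_pow_of_one_lt 1 (by norm_num : (1:ℝ) < 2)
    have b := tendsto_pow_const_div_const_pow_of_one_lt 0 (by norm_num : (1:ℝ) < 2)
    have c := b.add a
    simp only [add_zero] at c
    refine c.congr fun n => ?_
    rw [pow_zero, pow_one, add_div]
  have h2 : Filter.Tendsto (fun n : ℕ => (1 + (n:ℝ)) / 2 ^ n + 4 * U n) Filter.atTop (nhds 0) := by
    simpa using h1.add (hU.const_mul 4)
  refine squeeze_zero' (Filter.Eventually.of_forall fun n => dist_nonneg) ?_ h2
  filter_upwards [hev] with n hn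
  obtain ⟨hn1, hp0, hp1, hW⟩ := hn
  rw [Real.dist_eq]
  refine (main_bound hn1 hp0 hp1).trans ?_
  linarith
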